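/- Let f be an odd positive integer and let σ be the ring automorphism of ℤ[√−2]/fℤ[√−2] induced by √−2 ↦ −√−2. Then every unit u of ℤ[√−2]/fℤ[√−2] satisfying u·σ(u) = 1 is of the form σ(v)·v⁻¹ for some unit v of ℤ[√−2]/fℤ[√−2]. (Equivalently, H¹(Gal(ℚ(√−2)/ℚ), (ℤ[√−2]/fℤ[√−2])ˣ) = 0.) -/

import Mathlib

noncomputable section
open Complex

/-- `√−2 = i·√2` -/
def sm2 : ℂ := Complex.I * Real.sqrt 2
/-- `𝒪 = ℤ[√−2]`, the ring of integers of `ℚ(√−2)`. -/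
def OO : Subring ℂ := Subring.closure {sm2}

lemma conj_sm2 : (starRingEnd ℂ) sm2 = -sm2 := by
  simp [sm2]

/-- `ℤ[√−2]` is stable under `√−2 ↦ −√−2`, i.e. complex conjugation. -/
lemma conj_mem_OO : ∀ x ∈ OO, (starRingEnd ℂ) x ∈ OO := by
  intro x hx
  induction hx using Subring.closure_induction with
  | mem y hy =>
      rcases hy with rfl
      rw [conj_sm2]
      exact neg_mem (Subring.subset_closure rfl)
  | one => simpa using one_mem OO
  | zero => simpa using zero_mem OO
  | add x y hx hy ihx ihy => rw [map_add]; exact add_mem ihx ihy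
  | neg x hx ihx => rw [map_neg]; exact neg_mem ihx
  | mul x y hx hy ihx ihy => rw [map_mul]; exact mul_mem ihx ihy

/-- The automorphism `√−2 ↦ −√−2` (complex conjugation) of `ℤ[√−2]`. -/
def subringConj (R : Subring ℂ) (h : ∀ x ∈ R, (starRingEnd ℂ) x ∈ R) : R →+* R where
  toFun x := ⟨(starRingEnd ℂ) x, h x x.2⟩
  map_one' := Subtype.ext (by simp)
  map_mul' x y := Subtype.ext (by simp)
  map_zero' := Subtype.ext (by simp)
  map_add' x y := Subtype.ext (by simp)

/-- The ideal `f·R` of a subring `R` of `ℂ`. -/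
def fIdeal (R : Subring ℂ) (f : ℕ) : Ideal R := Ideal.span {(f : R)}

/-- The ring automorphism `σ` of `ℤ[√−2]/fℤ[√−2]` induced by `√−2 ↦ −√−2`. -/
def quotConj (R : Subring ℂ) (hc : ∀ x ∈ R, (starRingEnd ℂ) x ∈ R) (f : ℕ) :
    R ⧸ fIdeal R f →+* R ⧸ fIdeal R f :=
  Ideal.quotientMap _ (subringConj R hc) (by
    rw [fIdeal, Ideal.span_le]
    intro x hx
    rcases Set.mem_singleton_iff.1 hx with rfl
    show subringConj R hc ((f : ℕ) : R) ∈ fIdeal R f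
    rw [map_natCast]
    exact Ideal.subset_span rfl)

lemma sm2_mul_self : sm2 * sm2 = -2 := by
  have h : (Real.sqrt 2 : ℂ) * Real.sqrt 2 = 2 := by
    exact_mod_cast Real.mul_self_sqrt (by norm_num : (0 : ℝ) ≤ 2)
  rw [sm2]
  linear_combination Complex.I * Complex.I * h + 2 * Complex.I_mul_I

/-- Every element of `ℤ[√−2]` is of the form `a + b√−2` with integers `a`, `b`. -/
lemma exists_eq_add_mul_sm2 {x : ℂ} (hx : x ∈ OO) : ∃ a b : ℤ, x = a + b * sm2 := by
  induction hx using Subring.closure_induction with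
  | mem y hy => exact ⟨0, 1, by rw [Set.mem_singleton_iff.1 hy]; simp⟩
  | one => exact ⟨1, 0, by simp⟩
  | zero => exact ⟨0, 0, by simp⟩
  | add x y hx hy ihx ihy =>
      obtain ⟨a, b, rfl⟩ := ihx
      obtain ⟨c, d, rfl⟩ := ihy
      exact ⟨a + c, b + d, by push_cast; ring⟩
  | neg x hx ihx =>
      obtain ⟨a, b, rfl⟩ := ihx
      exact ⟨-a, -b, by push_cast; ring⟩
  | mul x y hx hy ihx ihy =>
      obtain ⟨a, b, rfl⟩ := ihx
      obtain ⟨c, d, rfl⟩ := ihy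
      exact ⟨a * c - 2 * b * d, a * d + b * c, by
        push_cast; linear_combination (b * d : ℂ) * sm2_mul_self⟩

/-- `√−2` as an element of `ℤ[√−2]`. -/
def sqrtNegTwo : OO := ⟨sm2, Subring.subset_closure rfl⟩

lemma sqrtNegTwo_mul_self : sqrtNegTwo * sqrtNegTwo = -2 :=
  Subtype.ext sm2_mul_self

lemma dvd_of_intCast_mem_fIdeal {f : ℕ} {n : ℤ} (h : (n : OO) ∈ fIdeal OO f) :
    (f : ℤ) ∣ n := by
  obtain ⟨x, hx⟩ := Ideal.mem_span_singleton'.1 h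
  obtain ⟨c, d, hcd⟩ := exists_eq_add_mul_sm2 x.2
  have hx' : (x : ℂ) * f = n := by exact_mod_cast congrArg Subtype.val hx
  rw [hcd] at hx'
  have hre := congrArg Complex.re hx'
  simp [sm2] at hre
  exact ⟨c, by rw [mul_comm]; exact_mod_cast hre.symm⟩

lemma isUnit_intCast_of_isCoprime {f : ℕ} {n : ℤ} (h : IsCoprime n (f : ℤ)) :
    IsUnit (n : OO ⧸ fIdeal OO f) := by
  obtain ⟨k, l, hkl⟩ := h
  have hf : (f : OO ⧸ fIdeal OO f) = 0 := by
    rw [← map_natCast (Ideal.Quotient.mk (fIdeal OO f))]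
    exact Ideal.Quotient.eq_zero_iff_mem.2 (Ideal.subset_span rfl)
  have hkl' : (k : OO ⧸ fIdeal OO f) * n + l * f = 1 := by
    exact_mod_cast congrArg (Int.cast : ℤ → OO ⧸ fIdeal OO f) hkl
  rw [hf, mul_zero, add_zero] at hkl'
  exact IsUnit.of_mul_eq_one k (by rw [mul_comm]; exact hkl')

/-- There is an integer whose prime divisors among those of `f` are exactly the ones
not dividing `n`. -/
lemma exists_dvd_iff_not_dvd {f : ℕ} (hf : f ≠ 0) (n : ℤ) :
    ∃ y : ℤ, ∀ p : ℕ, p.Prime → p ∣ f → ((p : ℤ) ∣ y ↔ ¬ (p : ℤ) ∣ n) := by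
  classical
  refine ⟨((∏ q ∈ f.primeFactors with ¬ ((q : ℕ) : ℤ) ∣ n, q : ℕ) : ℤ), fun p hp hpf => ?_⟩
  rw [Int.natCast_dvd_natCast, hp.prime.dvd_finsetProd_iff]
  constructor
  · rintro ⟨q, hq, hpq⟩
    rw [Finset.mem_filter] at hq
    rw [(Nat.prime_dvd_prime_iff_eq hp (Nat.prime_of_mem_primeFactors hq.1)).1 hpq]
    exact hq.2
  · intro h
    exact ⟨p, Finset.mem_filter.2 ⟨Nat.mem_primeFactors.2 ⟨hp, hpf, hf⟩, h⟩, dvd_rfl⟩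

/-- If `a + b√−2` has norm one modulo the odd integer `f`, some combination of the two
Hilbert 90 resolvents `1 + (a - b√−2)` and `√−2 (1 - (a - b√−2))` has norm prime to `f`. -/
lemma exists_isCoprime_norm_resolvent {f : ℕ} (hf1 : Odd f) (hf0 : f ≠ 0) {a b : ℤ}
    (h : (f : ℤ) ∣ a ^ 2 + 2 * b ^ 2 - 1) :
    ∃ y : ℤ, IsCoprime ((1 + a - 2 * b * y) ^ 2 + 2 * ((1 - a) * y - b) ^ 2) (f : ℤ) := by
  obtain ⟨y, hy⟩ := exists_dvd_iff_not_dvd hf0 (1 + a)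
  refine ⟨y, Int.isCoprime_iff_gcd_eq_one.2
    (Nat.eq_one_iff_not_exists_prime_dvd.2 fun p hp hpg => ?_)⟩
  have hpM := (Int.natCast_dvd_natCast.2 hpg).trans (Int.gcd_dvd_left _ _)
  have hpf : p ∣ f := Int.natCast_dvd_natCast.1
    ((Int.natCast_dvd_natCast.2 hpg).trans (Int.gcd_dvd_right _ _))
  have hE := (Int.natCast_dvd_natCast.2 hpf).trans h
  have hpp : Prime (p : ℤ) := Nat.prime_iff_prime_int.1 hp
  have hp2 : ¬ (p : ℤ) ∣ 2 := fun h2 => by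
    have h2' : p = 2 := (Nat.prime_dvd_prime_iff_eq hp Nat.prime_two).1 (by exact_mod_cast h2)
    exact (Nat.not_even_iff_odd.2 hf1) (even_iff_two_dvd.2 (h2' ▸ hpf))
  obtain ⟨m, hm⟩ := hpM
  obtain ⟨e, he⟩ := hE
  by_cases ha : (p : ℤ) ∣ 1 + a
  · have hpy : ¬ (p : ℤ) ∣ y := fun h' => (hy p hp hpf).1 h' ha
    obtain ⟨c, hc⟩ := ha
    have hb : (p : ℤ) ∣ b := by
      have hbb : (p : ℤ) ∣ 2 * b ^ 2 := ⟨e - (a - 1) * c, by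
        linear_combination he - (a - 1) * hc⟩
      exact hpp.dvd_of_dvd_pow ((hpp.dvd_or_dvd hbb).resolve_left hp2)
    obtain ⟨d, hd⟩ := hb
    have hyy : (p : ℤ) ∣ 2 ^ 3 * y ^ 2 :=
      ⟨m - 2 * c - e + 8 * d * y + y ^ 2 * (4 * c - 2 * e), by
        linear_combination hm - 2 * hc - he + 8 * y * hd + y ^ 2 * (4 * hc - 2 * he)⟩
    rcases hpp.dvd_or_dvd hyy with h' | h'
    · exact hp2 (hpp.dvd_of_dvd_pow h')
    · exact hpy (hpp.dvd_of_dvd_pow h')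
  · obtain ⟨z, hz⟩ := (hy p hp hpf).2 ha
    have h2a : (p : ℤ) ∣ 2 * (1 + a) :=
      ⟨m - e + 8 * b * z - y * z * (4 * (1 - a)) - 2 * y ^ 2 * e, by
        linear_combination hm - he + 8 * b * hz - y * (4 * (1 - a)) * hz - 2 * y ^ 2 * he⟩
    exact (hpp.dvd_or_dvd h2a).elim hp2 ha

lemma subringConj_sqrtNegTwo : subringConj OO conj_mem_OO sqrtNegTwo = -sqrtNegTwo :=
  Subtype.ext conj_sm2

/-- Let `f` be an odd positive integer and `σ` the automorphism of
`ℤ[√−2]/fℤ[√−2]` induced by `√−2 ↦ −√−2`.  Every unit `u` with `u·σ(u) = 1` is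
of the form `σ(v)·v⁻¹`; i.e. `H¹(Gal(ℚ(√−2)/ℚ), (ℤ[√−2]/fℤ[√−2])ˣ) = 0`. -/
theorem hilbert90_for_quotient (f : ℕ) (hf1 : Odd f) (hf0 : 0 < f)
    (u : (OO ⧸ fIdeal OO f)ˣ)
    (hu : u * Units.map (quotConj OO conj_mem_OO f).toMonoidHom u = 1) :
    ∃ v : (OO ⧸ fIdeal OO f)ˣ,
      u = Units.map (quotConj OO conj_mem_OO f).toMonoidHom v * v⁻¹ := by
  obtain ⟨x, hx⟩ := Ideal.Quotient.mk_surjective (u : OO ⧸ fIdeal OO f)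
  obtain ⟨a, b, hab⟩ := exists_eq_add_mul_sm2 x.2
  replace hab : x = a + b * sqrtNegTwo := Subtype.ext (by rw [hab]; simp [sqrtNegTwo])
  set s : OO ⧸ fIdeal OO f := Ideal.Quotient.mk _ sqrtNegTwo with hs
  have hss : s * s = -2 := by
    rw [hs, ← map_mul, sqrtNegTwo_mul_self, map_neg, map_ofNat]
  set σ := quotConj OO conj_mem_OO f with hσ
  have hσs : σ s = -s := by
    rw [hσ, hs, quotConj, Ideal.quotientMap_mk, subringConj_sqrtNegTwo, map_neg]
  have hu_eq : (u : OO ⧸ fIdeal OO f) = a + b * s := by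
    rw [← hx, hab, map_add, map_mul, map_intCast, map_intCast]
  have hnorm : (a + b * s) * (a - b * s) = 1 := by
    have h : (u : OO ⧸ fIdeal OO f) * σ u = 1 := congrArg Units.val hu
    rw [hu_eq, map_add, map_mul, map_intCast, map_intCast, hσs] at h
    rw [← h]; ring
  have hdvd : (f : ℤ) ∣ a ^ 2 + 2 * b ^ 2 - 1 := by
    refine dvd_of_intCast_mem_fIdeal (Ideal.Quotient.eq_zero_iff_mem.1 ?_)
    rw [map_intCast]
    push_cast
    linear_combination hnorm + (b : OO ⧸ fIdeal OO f) ^ 2 * hss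
  obtain ⟨y, hy⟩ := exists_isCoprime_norm_resolvent hf1 hf0.ne' hdvd
  have hM := isUnit_intCast_of_isCoprime hy
  push_cast at hM
  set v : OO ⧸ fIdeal OO f := (1 + (a - b * s)) + y * (s * (1 - (a - b * s))) with hv
  have hσv : σ v = (1 + (a + b * s)) - y * (s * (1 - (a + b * s))) := by
    simp only [hv, map_add, map_sub, map_mul, map_intCast, map_one, hσs]
    ring
  have hunit : IsUnit v := by
    refine isUnit_of_mul_isUnit_left (y := σ v) ?_
    rw [hσv, hv]
    convert hM using 1
    linear_combination (-((1 - a) * y - b) ^ 2 + 2 * (1 + a - 2 * b * y) * y * b +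
      y ^ 2 * b ^ 2 * (s * s + 2)) * hss
  refine ⟨hunit.unit, eq_mul_inv_of_mul_eq (Units.ext ?_)⟩
  change (u : OO ⧸ fIdeal OO f) * v = σ v
  rw [hσv, hv, hu_eq]
  linear_combination (1 - y * s) * hnorm
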